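/- arXiv:2510.24234 — 5 statements merged into one kernel-verified Lean document; each statement's English description precedes it below -/
import Mathlib

section
/- Let 𝒜 be a finite nonempty set, let Δ̂ : 𝒜 → ℝ satisfy Δ̂(a) ≥ 0 for all a ∈ 𝒜, and let G : 𝒜 → ℝ satisfy G(a) > 0 for all a ∈ 𝒜. For a probability vector π on 𝒜 and a real γ ≥ 2, define the generalized information ratio IR^γ(π) = (∑_{a∈𝒜} π(a)Δ̂(a))^γ / (∑_{a∈𝒜} π(a)G(a)). If π* is a probability vector on 𝒜 that minimizes IR²(π) over all probability vectors π on 𝒜, then for every real γ ≥ 2 and every probability vector π on 𝒜, IR^γ(π*) ≤ 2^{γ−2} · IR^γ(π). -/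
open Finset

/-- A probability vector on a finite set: nonnegative entries summing to one. -/
def IsProbVec {α : Type*} [Fintype α] (π : α → ℝ) : Prop :=
  (∀ a, 0 ≤ π a) ∧ ∑ a, π a = 1

/-- The generalized information ratio of parameter `γ` of a policy `π`,
with expected-regret vector `Δ` and information-gain vector `G`. -/
noncomputable def infoRatio {α : Type*} [Fintype α] (Δ G : α → ℝ) (γ : ℝ) (π : α → ℝ) : ℝ :=
  (∑ a, π a * Δ a) ^ γ / (∑ a, π a * G a)

/-- The expectation of a positive function under a probability vector is positive. -/
theorem IsProbVec.sum_mul_pos {α : Type*} [Fintype α] {π f : α → ℝ}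
    (hπ : IsProbVec π) (hf : ∀ a, 0 < f a) : 0 < ∑ a, π a * f a := by
  obtain ⟨a, -, ha⟩ : ∃ a ∈ Finset.univ, 0 < π a :=
    (Finset.sum_pos_iff_of_nonneg fun a _ => hπ.1 a).1 (hπ.2 ▸ one_pos)
  exact Finset.sum_pos' (fun b _ => mul_nonneg (hπ.1 b) (hf b).le)
    ⟨a, Finset.mem_univ a, mul_pos ha (hf a)⟩

/-- A mixture of probability vectors is a probability vector. -/
theorem IsProbVec.mix {α : Type*} [Fintype α] {π ρ : α → ℝ} (hπ : IsProbVec π)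
    (hρ : IsProbVec ρ) {t : ℝ} (ht0 : 0 ≤ t) (ht1 : t ≤ 1) :
    IsProbVec fun a => (1 - t) * π a + t * ρ a := by
  refine ⟨fun a => add_nonneg (mul_nonneg (sub_nonneg.2 ht1) (hπ.1 a))
    (mul_nonneg ht0 (hρ.1 a)), ?_⟩
  rw [Finset.sum_add_distrib, ← Finset.mul_sum, ← Finset.mul_sum, hπ.2, hρ.2]
  ring

/-- The information ratio is quadratic over linear, so a mixture of the `2`-minimizer with
another policy controls the regret of the minimizer by twice that of the other policy. -/
theorem regret_le_two_mul_of_min_two_info_ratio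
    {α : Type*} [Fintype α]
    {Δ G : α → ℝ} (hΔ : ∀ a, 0 ≤ Δ a) (hG : ∀ a, 0 < G a)
    {πstar : α → ℝ} (hπstar : IsProbVec πstar)
    (hmin : ∀ π : α → ℝ, IsProbVec π → infoRatio Δ G 2 πstar ≤ infoRatio Δ G 2 π)
    {π : α → ℝ} (hπ : IsProbVec π) :
    ∑ a, πstar a * Δ a ≤ 2 * ∑ a, π a * Δ a := by
  have hg := hπstar.sum_mul_pos hG
  have hh := hπ.sum_mul_pos hG
  have hy : 0 ≤ ∑ a, π a * Δ a := Finset.sum_nonneg fun a _ => mul_nonneg (hπ.1 a) (hΔ a)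
  have key : ∀ t : ℝ, 0 ≤ t → t ≤ 1 →
      (∑ a, πstar a * Δ a) ^ 2 / (∑ a, πstar a * G a) ≤
        ((1 - t) * (∑ a, πstar a * Δ a) + t * ∑ a, π a * Δ a) ^ 2 /
          ((1 - t) * (∑ a, πstar a * G a) + t * ∑ a, π a * G a) := by
    intro t ht0 ht1
    have h := hmin _ (hπstar.mix hπ ht0 ht1)
    simpa only [infoRatio, Real.rpow_two, add_mul, mul_assoc, Finset.sum_add_distrib,
      ← Finset.mul_sum] using h
  generalize (∑ a, πstar a * Δ a) = x at *
  generalize (∑ a, π a * Δ a) = y at *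
  generalize (∑ a, πstar a * G a) = g at *
  generalize (∑ a, π a * G a) = h at *
  by_contra! hxy
  have hx : 0 < x := by linarith
  have hgh : 0 < g + h := by linarith
  obtain ⟨t, ht0, ht1, htg⟩ : ∃ t : ℝ, 0 < t ∧ t ≤ 1 ∧ t * g ≤ h := by
    refine ⟨h / (g + h), by positivity, (div_le_one hgh).2 (by linarith), ?_⟩
    rw [div_mul_eq_mul_div, div_le_iff₀ hgh]
    nlinarith
  have hk := key t ht0.le ht1
  have hden : 0 < (1 - t) * g + t * h :=
    add_pos_of_nonneg_of_pos (mul_nonneg (by linarith) hg.le) (mul_pos ht0 hh)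
  rw [div_le_div_iff₀ hg hden] at hk
  have hfirst : x ^ 2 * (h - g) ≤ 2 * x * (y - x) * g + t * g * (y - x) ^ 2 := by
    refine le_of_mul_le_mul_left ?_ ht0
    linarith
  have hsq : (y - x) ^ 2 ≤ x ^ 2 := by nlinarith
  have hbound : t * g * (y - x) ^ 2 ≤ h * x ^ 2 :=
    mul_le_mul htg hsq (sq_nonneg _) hh.le
  have hpos : 0 < x * g * (x - 2 * y) := by
    have : 0 < x - 2 * y := by linarith
    positivity
  linarith

/-- A minimizer of the 2-information ratio is a `2^(γ-2)`-approximate minimizer of the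
`γ`-information ratio for every `γ ≥ 2`. -/
theorem soids_approx_min_of_min_two_info_ratio
    {α : Type*} [Fintype α] [Nonempty α]
    (Δ G : α → ℝ) (hΔ : ∀ a, 0 ≤ Δ a) (hG : ∀ a, 0 < G a)
    (πstar : α → ℝ) (hπstar : IsProbVec πstar)
    (hmin : ∀ π : α → ℝ, IsProbVec π → infoRatio Δ G 2 πstar ≤ infoRatio Δ G 2 π)
    (γ : ℝ) (hγ : 2 ≤ γ) (π : α → ℝ) (hπ : IsProbVec π) :
    infoRatio Δ G γ πstar ≤ 2 ^ (γ - 2) * infoRatio Δ G γ π := by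
  have hle := regret_le_two_mul_of_min_two_info_ratio hΔ hG hπstar hmin hπ
  have hratio := hmin π hπ
  have hg := hπstar.sum_mul_pos hG
  have hh := hπ.sum_mul_pos hG
  have hx : 0 ≤ ∑ a, πstar a * Δ a :=
    Finset.sum_nonneg fun a _ => mul_nonneg (hπstar.1 a) (hΔ a)
  have hy : 0 ≤ ∑ a, π a * Δ a := Finset.sum_nonneg fun a _ => mul_nonneg (hπ.1 a) (hΔ a)
  unfold infoRatio at hratio ⊢
  generalize (∑ a, πstar a * Δ a) = x at *
  generalize (∑ a, π a * Δ a) = y at *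
  generalize (∑ a, πstar a * G a) = g at *
  generalize (∑ a, π a * G a) = h at *
  have hsplit : ∀ z : ℝ, 0 ≤ z → z ^ γ = z ^ (γ - 2) * z ^ (2 : ℝ) := fun z hz => by
    rw [← Real.rpow_add_of_nonneg hz (by linarith) (by norm_num), sub_add_cancel]
  calc x ^ γ / g = x ^ (γ - 2) * (x ^ (2 : ℝ) / g) := by rw [hsplit x hx, mul_div_assoc]
    _ ≤ (2 * y) ^ (γ - 2) * (y ^ (2 : ℝ) / h) := by
      have hγ' : 0 ≤ γ - 2 := by linarith
      gcongr
    _ = 2 ^ (γ - 2) * (y ^ γ / h) := by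
      rw [Real.mul_rpow (by norm_num) hy, hsplit y hy]
      ring
end

section
/- Let a ≥ 1 and b ≥ 0 be real numbers. Then every real t with t ≥ 2·a·log(e·a) + 2·b satisfies t ≥ a·log(e·t) + b. -/
/-- For `a ≥ 1` and `b ≥ 0`, every `t ≥ 2a·log(ea) + 2b` satisfies `t ≥ a·log(et) + b`. -/
theorem ge_of_ge_two_a_log_ea (a b : ℝ) (ha : 1 ≤ a) (hb : 0 ≤ b) (t : ℝ)
    (ht : 2 * a * Real.log (Real.exp 1 * a) + 2 * b ≤ t) :
    a * Real.log (Real.exp 1 * t) + b ≤ t := by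
  have ha0 : 0 < a := by linarith
  have hL : 0 ≤ Real.log a := Real.log_nonneg ha
  rw [Real.log_mul (Real.exp_ne_zero 1) ha0.ne', Real.log_exp] at ht
  have haL : 0 ≤ a * Real.log a := mul_nonneg ha0.le hL
  have ht0 : 0 < t := by linarith
  rw [Real.log_mul (Real.exp_ne_zero 1) ht0.ne', Real.log_exp]
  have htangent : Real.log (t / (2 * a)) ≤ t / (2 * a) - 1 :=
    Real.log_le_sub_one_of_pos (by positivity)
  rw [Real.log_div ht0.ne' (by positivity), Real.log_mul two_ne_zero ha0.ne'] at htangent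
  have hscaled := mul_le_mul_of_nonneg_left htangent ha0.le
  have hcancel : a * (t / (2 * a) - 1) = t / 2 - a := by field_simp
  have hlog2 : a * Real.log 2 ≤ a * 1 :=
    mul_le_mul_of_nonneg_left (by linarith [Real.log_two_lt_d9]) ha0.le
  linarith
end

section
/- Let ε be a real-valued random variable on a probability space satisfying the sub-Gaussian moment bound E[exp(t·ε)] ≤ exp(t²/2) for every t ∈ ℝ (with exp(t·ε) integrable for every t). Let r₀, r, c ∈ ℝ and set Y = r₀ + ε. Then E[ exp( −c·( (Y − r)²/2 − (Y − r₀)²/2 ) ) ] ≤ exp( −(r − r₀)²·(c/2)·(1 − c) ). -/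
open MeasureTheory

/-- Expected power of a Gaussian likelihood ratio under 1-sub-Gaussian noise:
with `Y = r₀ + ε`,
`E[exp(−c((Y−r)²/2 − (Y−r₀)²/2))] ≤ exp(−(r−r₀)²·(c/2)·(1−c))`. -/
theorem likelihood_ratio_power_bound {Ω : Type*} [MeasurableSpace Ω] (μ : Measure Ω)
    [IsProbabilityMeasure μ] (ε : Ω → ℝ)
    (hint : ∀ t : ℝ, Integrable (fun ω => Real.exp (t * ε ω)) μ)
    (hsub : ∀ t : ℝ, ∫ ω, Real.exp (t * ε ω) ∂μ ≤ Real.exp (t ^ 2 / 2))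
    (r₀ r c : ℝ) :
    ∫ ω, Real.exp (-c * (((r₀ + ε ω) - r) ^ 2 / 2 - ((r₀ + ε ω) - r₀) ^ 2 / 2)) ∂μ ≤
      Real.exp (-(r - r₀) ^ 2 * (c / 2) * (1 - c)) := by
  have exponent_split : ∀ ω,
      Real.exp (-c * (((r₀ + ε ω) - r) ^ 2 / 2 - ((r₀ + ε ω) - r₀) ^ 2 / 2)) =
        Real.exp (-c * (r - r₀) ^ 2 / 2) * Real.exp (c * (r - r₀) * ε ω) := by
    intro ω
    rw [← Real.exp_add]
    ring_nf
  simp_rw [exponent_split]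
  rw [integral_const_mul]
  calc Real.exp (-c * (r - r₀) ^ 2 / 2) * ∫ ω, Real.exp (c * (r - r₀) * ε ω) ∂μ
      ≤ Real.exp (-c * (r - r₀) ^ 2 / 2) * Real.exp ((c * (r - r₀)) ^ 2 / 2) := by
        gcongr
        exact hsub _
    _ = Real.exp (-(r - r₀) ^ 2 * (c / 2) * (1 - c)) := by
        rw [← Real.exp_add]
        ring_nf
end

section
/- For every integer n ≥ 0 and every real n × n matrix M, (trace M)² ≤ rank(M) · ∑_{i,j} (M_{ij})², i.e., the square of the trace of M is at most the rank of M times the square of the Frobenius norm of M. -/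
open Matrix

/-- The orthogonal projection onto the column space of a real square matrix, as a matrix. -/
theorem Matrix.exists_isStarProjection_mul_eq_self {n : Type*} [Fintype n] [DecidableEq n]
    (M : Matrix n n ℝ) :
    ∃ P : Matrix n n ℝ, IsStarProjection P ∧ P * M = M ∧ P.trace = M.rank := by
  let e : Matrix n n ℝ ≃⋆ₐ[ℝ] _ := toEuclideanCLM (n := n) (𝕜 := ℝ)
  let U := LinearMap.range (toEuclideanLin M)
  have hP : toEuclideanLin (e.symm U.starProjection) = U.starProjection.toLinearMap := by
    rw [← coe_toEuclideanCLM_eq_toEuclideanLin]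
    exact congrArg _ (e.apply_symm_apply _)
  refine ⟨e.symm U.starProjection, ⟨?_, ?_⟩, ?_, ?_⟩
  · exact (map_mul e.symm _ _).symm.trans
      (congrArg e.symm U.isIdempotentElem_starProjection.eq)
  · exact (map_star e.symm _).symm.trans
      (congrArg e.symm (isSelfAdjoint_starProjection U).star_eq)
  · apply toEuclideanLin.injective
    rw [toLpLin_mul_same, hP]
    ext1 x
    exact Submodule.starProjection_eq_self_iff.mpr (LinearMap.mem_range_self _ x)
  · have hproj : LinearMap.IsProj U U.starProjection.toLinearMap :=
      ⟨U.starProjection_apply_mem, fun _ ↦ Submodule.starProjection_eq_self_iff.mpr⟩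
    calc
      (e.symm U.starProjection).trace
          = LinearMap.trace ℝ _ (toEuclideanLin (e.symm U.starProjection)) :=
        (trace_toLin_eq _ (PiLp.basisFun 2 ℝ n)).symm
      _ = Module.finrank ℝ U := by rw [hP, hproj.trace]
      _ = M.rank := congrArg Nat.cast
        (M.rank_eq_finrank_range_toLin (PiLp.basisFun 2 ℝ n) (PiLp.basisFun 2 ℝ n)).symm

/-- A real star projection has squared Frobenius norm equal to its trace. -/
theorem IsStarProjection.sum_sq_eq_trace {n : Type*} [Fintype n] {P : Matrix n n ℝ}
    (hP : IsStarProjection P) : ∑ i, ∑ j, P i j ^ 2 = P.trace := by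
  have hsymm (i j : n) : P j i = P i j := by
    simpa using congrFun₂ hP.isSelfAdjoint.star_eq i j
  rw [← congrArg Matrix.trace hP.isIdempotentElem.eq]
  simp [Matrix.trace, Matrix.mul_apply, hsymm, sq]

/-- The Cauchy-Schwarz inequality for the Frobenius pairing of real matrices. -/
theorem Matrix.trace_mul_sq_le {m n : Type*} [Fintype m] [Fintype n]
    (A : Matrix m n ℝ) (B : Matrix n m ℝ) :
    (A * B).trace ^ 2 ≤ (∑ i, ∑ j, A i j ^ 2) * ∑ i, ∑ j, B i j ^ 2 := by
  have h := Finset.sum_mul_sq_le_sq_mul_sq Finset.univ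
    (fun p : m × n ↦ A p.1 p.2) (fun p ↦ B p.2 p.1)
  simp only [Fintype.sum_prod_type] at h
  rw [Finset.sum_comm (f := fun i j ↦ B i j ^ 2)]
  simpa only [Matrix.trace, diag_apply, mul_apply] using h

/-- The square of the trace of a square real matrix is at most its rank times the
square of its Frobenius norm. -/
theorem trace_sq_le_rank_mul_frobenius_sq (n : ℕ) (M : Matrix (Fin n) (Fin n) ℝ) :
    (Matrix.trace M) ^ 2 ≤ (M.rank : ℝ) * ∑ i, ∑ j, (M i j) ^ 2 := by
  obtain ⟨P, hP, hPM, htrace⟩ := M.exists_isStarProjection_mul_eq_self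
  simpa only [hPM, hP.sum_sq_eq_trace, htrace] using P.trace_mul_sq_le M
end

section
/- Let d, s, T be integers with 1 ≤ s ≤ d and T ≥ 1, and set C_t = 5 + 2·s·log(e·d·t/s) for integers t ≥ 1. (i) Define λ²_t = √( 3·C_{t+1} / (128·d·(t+1)) ) for t ≥ 0. Then for every sequence x₁, …, x_T of reals with 0 ≤ x_t ≤ 2d for all t, one has C_T/λ²_{T−1} + (32/3)·∑_{t=1}^{T} λ²_{t−1}·x_t ≤ 16·√( (2/3)·C_T·d·T ). (ii) Let C_min > 0 and define λ³_t = (1/(4·6^{1/3}))·( C_{t+1}·√C_min / ((t+1)·√s) )^{2/3} for t ≥ 0, and let c₃* = 2·3^{−3/2}. Then for every sequence y₁, …, y_T of reals with 0 ≤ y_t ≤ 54·s/C_min for all t, one has C_T/λ³_{T−1} + (16/3)·c₃*·∑_{t=1}^{T} √( 3·λ³_{t−1}·y_t ) ≤ 12·6^{1/3}·( s·C_T/C_min )^{1/3}·T^{2/3}. -/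
open Finset

lemma rpow_one_third_pow_three {a : ℝ} (ha : 0 ≤ a) : (a ^ ((1 : ℝ) / 3)) ^ 3 = a := by
  rw [← Real.rpow_natCast, ← Real.rpow_mul ha]
  norm_num

lemma rpow_two_thirds_eq_sq {a : ℝ} (ha : 0 ≤ a) :
    a ^ ((2 : ℝ) / 3) = (a ^ ((1 : ℝ) / 3)) ^ 2 := by
  rw [← Real.rpow_natCast, ← Real.rpow_mul ha]
  norm_num

lemma sum_Icc_inv_sqrt_le (n : ℕ) : ∑ t ∈ Icc 1 n, (√(t : ℝ))⁻¹ ≤ 2 * √(n : ℝ) := by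
  induction n with
  | zero => simp
  | succ n ih =>
    rw [sum_Icc_succ_top (by lia)]
    have hp : 0 < √((n + 1 : ℕ) : ℝ) := Real.sqrt_pos.2 (by positivity)
    have hp2 := Real.sq_sqrt (show (0 : ℝ) ≤ ((n + 1 : ℕ) : ℝ) by positivity)
    have hq2 := Real.sq_sqrt (show (0 : ℝ) ≤ (n : ℝ) by positivity)
    set p := √((n + 1 : ℕ) : ℝ)
    set q := √(n : ℝ)
    push_cast at hp2
    have hstep : p⁻¹ ≤ 2 * p - 2 * q := by
      rw [inv_le_iff_one_le_mul₀ hp]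
      nlinarith [sq_nonneg (p - q)]
    linarith

lemma sum_Icc_inv_cbrt_le (n : ℕ) :
    ∑ t ∈ Icc 1 n, ((t : ℝ) ^ ((1 : ℝ) / 3))⁻¹ ≤ 3 / 2 * ((n : ℝ) ^ ((1 : ℝ) / 3)) ^ 2 := by
  induction n with
  | zero => simp
  | succ n ih =>
    rw [sum_Icc_succ_top (by lia)]
    have hp : 0 < ((n + 1 : ℕ) : ℝ) ^ ((1 : ℝ) / 3) := by positivity
    have hq : 0 ≤ (n : ℝ) ^ ((1 : ℝ) / 3) := by positivity
    have hp3 := rpow_one_third_pow_three (show (0 : ℝ) ≤ ((n + 1 : ℕ) : ℝ) by positivity)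
    have hq3 := rpow_one_third_pow_three (show (0 : ℝ) ≤ (n : ℝ) by positivity)
    set p := ((n + 1 : ℕ) : ℝ) ^ ((1 : ℝ) / 3)
    set q := (n : ℝ) ^ ((1 : ℝ) / 3)
    push_cast at hp3
    have hstep : p⁻¹ ≤ 3 / 2 * p ^ 2 - 3 / 2 * q ^ 2 := by
      rw [inv_le_iff_one_le_mul₀ hp]
      nlinarith [mul_nonneg (sq_nonneg (p - q)) (by positivity : 0 ≤ p + 2 * q)]
    linarith

lemma three_rpow_neg_three_halves : (3 : ℝ) ^ (-(3 / 2) : ℝ) = (3 * √3)⁻¹ := by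
  rw [Real.rpow_neg (by norm_num), show (3 / 2 : ℝ) = 1 + 1 / 2 by norm_num,
    Real.rpow_add (by norm_num), Real.rpow_one, ← Real.sqrt_eq_rpow]

/-- The bound for the learning rate tuned to a `2`-information ratio. -/
lemma sqrt_rate_bound {C lam x : ℕ → ℝ} {d : ℝ} {T : ℕ} (hd : 0 < d) (hT : 1 ≤ T)
    (hpos : ∀ t, 1 ≤ t → 0 < C t) (hmono : ∀ t, 1 ≤ t → t ≤ T → C t ≤ C T)
    (hlam : ∀ t : ℕ, lam t = √(3 * C (t + 1) / (128 * d * (t + 1))))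
    (hx : ∀ t, 1 ≤ t → t ≤ T → 0 ≤ x t ∧ x t ≤ 2 * d) :
    C T / lam (T - 1) + (32 / 3) * ∑ t ∈ Icc 1 T, lam (t - 1) * x t ≤
      16 * √((2 / 3) * (C T * (d * T))) := by
  have hlam' : ∀ t : ℕ, 1 ≤ t → lam (t - 1) = √(3 / (128 * d)) * √(C t) * (√(t : ℝ))⁻¹ := by
    intro t ht
    obtain ⟨n, rfl⟩ := Nat.exists_eq_add_of_le' ht
    have := hpos (n + 1) ht
    rw [hlam, ← Real.sqrt_inv, ← Real.sqrt_mul (by positivity), ← Real.sqrt_mul (by positivity)]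
    congr 1
    simp only [Nat.add_sub_cancel]
    push_cast
    field_simp
  have hCT := hpos T hT
  have hTpos : (0 : ℝ) < T := by exact_mod_cast hT
  have hk : 0 < √(3 / (128 * d)) := Real.sqrt_pos.2 (by positivity)
  have hk2 := Real.sq_sqrt (show 0 ≤ 3 / (128 * d) by positivity)
  have hg : 0 < √(C T) := Real.sqrt_pos.2 hCT
  have hr : 0 < √(T : ℝ) := Real.sqrt_pos.2 hTpos
  have hg2 := Real.sq_sqrt hCT.le
  have hsum : ∑ t ∈ Icc 1 T, lam (t - 1) * x t ≤
      2 * d * √(3 / (128 * d)) * √(C T) * (2 * √(T : ℝ)) := by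
    refine le_trans ?_ (mul_le_mul_of_nonneg_left (sum_Icc_inv_sqrt_le T) (by positivity))
    rw [mul_sum]
    refine sum_le_sum fun t ht ↦ ?_
    obtain ⟨h1, h2⟩ := mem_Icc.1 ht
    rw [hlam' t h1]
    have hsq := Real.sqrt_le_sqrt (hmono t h1 h2)
    calc √(3 / (128 * d)) * √(C t) * (√(t : ℝ))⁻¹ * x t
        ≤ √(3 / (128 * d)) * √(C T) * (√(t : ℝ))⁻¹ * (2 * d) :=
          mul_le_mul (by gcongr) (hx t h1 h2).2 (hx t h1 h2).1 (by positivity)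
      _ = _ := by ring
  have hrhs : √((2 / 3) * (C T * (d * T))) =
      16 / 3 * d * √(3 / (128 * d)) * √(C T) * √(T : ℝ) := by
    have hcoef : 16 / 3 * d * √(3 / (128 * d)) = √(2 / 3 * d) := by
      rw [eq_comm, Real.sqrt_eq_iff_mul_self_eq (by positivity) (by positivity),
        ← sq, mul_pow, hk2]
      field_simp
      norm_num
    rw [hcoef, ← Real.sqrt_mul (by positivity), ← Real.sqrt_mul (by positivity)]
    congr 1
    ring
  have hdiv : C T / lam (T - 1) = 128 / 3 * d * √(3 / (128 * d)) * √(C T) * √(T : ℝ) := by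
    have hkd : d * √(3 / (128 * d)) ^ 2 = 3 / 128 := by rw [hk2]; field_simp
    rw [hlam' T hT, div_eq_iff (by positivity)]
    field_simp
    linear_combination (-3) * hg2 - 128 * √(C T) ^ 2 * hkd
  rw [hdiv, hrhs]
  linarith

/-- The bound for the learning rate tuned to a `3`-information ratio. -/
lemma cbrt_rate_bound {C lam y : ℕ → ℝ} {s m : ℝ} {T : ℕ} (hs : 0 < s) (hm : 0 < m)
    (hT : 1 ≤ T) (hpos : ∀ t, 1 ≤ t → 0 < C t) (hmono : ∀ t, 1 ≤ t → t ≤ T → C t ≤ C T)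
    (hlam : ∀ t : ℕ, lam t = (1 / (4 * (6 : ℝ) ^ ((1 : ℝ) / 3))) *
      (C (t + 1) * √m / ((t + 1) * √s)) ^ ((2 : ℝ) / 3))
    (hy : ∀ t, 1 ≤ t → t ≤ T → 0 ≤ y t ∧ y t ≤ 54 * s / m) :
    C T / lam (T - 1) +
        (16 / 3) * (2 * (3 : ℝ) ^ (-(3 / 2) : ℝ)) * ∑ t ∈ Icc 1 T, √(3 * lam (t - 1) * y t) ≤
      12 * (6 : ℝ) ^ ((1 : ℝ) / 3) * (s * C T / m) ^ ((1 : ℝ) / 3) * (T : ℝ) ^ ((2 : ℝ) / 3) := by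
  have ha : (0 : ℝ) < (6 : ℝ) ^ ((1 : ℝ) / 3) := by positivity
  have ha3 := rpow_one_third_pow_three (show (0 : ℝ) ≤ 6 by norm_num)
  have hw : 0 < (s / m) ^ ((1 : ℝ) / 3) := by positivity
  have hw3 := rpow_one_third_pow_three (div_pos hs hm).le
  set a := (6 : ℝ) ^ ((1 : ℝ) / 3)
  have hlam' : ∀ t : ℕ, 1 ≤ t → lam (t - 1) = (C t ^ ((1 : ℝ) / 3)) ^ 2 /
      (4 * a * (s / m) ^ ((1 : ℝ) / 3) * ((t : ℝ) ^ ((1 : ℝ) / 3)) ^ 2) := by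
    intro t ht
    obtain ⟨n, rfl⟩ := Nat.exists_eq_add_of_le' ht
    have hCt := hpos (n + 1) ht
    have hsq : (√m / √s) ^ ((2 : ℝ) / 3) = ((s / m) ^ ((1 : ℝ) / 3))⁻¹ := by
      rw [← Real.inv_rpow (by positivity), inv_div, ← Real.sqrt_div hm.le, Real.sqrt_eq_rpow,
        ← Real.rpow_mul (by positivity)]
      norm_num
    rw [hlam, Nat.add_sub_cancel, mul_div_mul_comm, Real.mul_rpow (by positivity) (by positivity),
      hsq, Real.div_rpow hCt.le (by positivity), rpow_two_thirds_eq_sq hCt.le,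
      rpow_two_thirds_eq_sq (by positivity)]
    push_cast
    field_simp
  have hCT := hpos T hT
  have hTpos : (0 : ℝ) < T := by exact_mod_cast hT
  have hg : 0 < C T ^ ((1 : ℝ) / 3) := by positivity
  have hr : 0 < (T : ℝ) ^ ((1 : ℝ) / 3) := by positivity
  have hg3 := rpow_one_third_pow_three hCT.le
  have hdiv : C T / lam (T - 1) = 4 * a * (s / m) ^ ((1 : ℝ) / 3) * C T ^ ((1 : ℝ) / 3) *
      ((T : ℝ) ^ ((1 : ℝ) / 3)) ^ 2 := by
    rw [hlam' T hT, div_eq_iff (by positivity)]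
    field_simp
    linear_combination -hg3
  have hrhs : (s * C T / m) ^ ((1 : ℝ) / 3) = (s / m) ^ ((1 : ℝ) / 3) * C T ^ ((1 : ℝ) / 3) := by
    rw [← Real.mul_rpow (by positivity) hCT.le]
    congr 1
    ring
  rw [hdiv, hrhs, rpow_two_thirds_eq_sq hTpos.le, three_rpow_neg_three_halves]
  set g := C T ^ ((1 : ℝ) / 3)
  set w := (s / m) ^ ((1 : ℝ) / 3)
  have hsum : ∑ t ∈ Icc 1 T, √(3 * lam (t - 1) * y t) ≤
      3 / 2 * √3 * a * w * g * (3 / 2 * ((T : ℝ) ^ ((1 : ℝ) / 3)) ^ 2) := by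
    refine le_trans ?_ (mul_le_mul_of_nonneg_left (sum_Icc_inv_cbrt_le T) (by positivity))
    rw [mul_sum]
    refine sum_le_sum fun t ht ↦ ?_
    obtain ⟨h1, h2⟩ := mem_Icc.1 ht
    have hCt := hpos t h1
    have ht0 : (0 : ℝ) < t := by exact_mod_cast h1
    have hle : C t ^ ((1 : ℝ) / 3) ≤ g := Real.rpow_le_rpow hCt.le (hmono t h1 h2) (by norm_num)
    have hu : 0 < (t : ℝ) ^ ((1 : ℝ) / 3) := by positivity
    rw [hlam' t h1]
    set u := (t : ℝ) ^ ((1 : ℝ) / 3)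
    refine Real.sqrt_le_iff.2 ⟨by positivity, ?_⟩
    calc 3 * ((C t ^ ((1 : ℝ) / 3)) ^ 2 / (4 * a * w * u ^ 2)) * y t
        ≤ 3 * (g ^ 2 / (4 * a * w * u ^ 2)) * (54 * w ^ 3) := by
          refine mul_le_mul (by gcongr) ?_ (hy t h1 h2).1 (by positivity)
          rw [hw3, ← mul_div_assoc]
          exact (hy t h1 h2).2
      _ = (3 / 2 * √3 * a * w * g * u⁻¹) ^ 2 := by
          have h3 := Real.sq_sqrt (show (0 : ℝ) ≤ 3 by norm_num)
          simp only [mul_pow, h3]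
          field_simp
          linear_combination (-36) * ha3
  have h3 : 0 < √(3 : ℝ) := by positivity
  have hcoef : 16 / 3 * (2 * (3 * √3)⁻¹) *
      (3 / 2 * √3 * a * w * g * (3 / 2 * ((T : ℝ) ^ ((1 : ℝ) / 3)) ^ 2)) =
      8 * a * w * g * ((T : ℝ) ^ ((1 : ℝ) / 3)) ^ 2 := by
    field_simp
    norm_num
  have := mul_le_mul_of_nonneg_left hsum (show 0 ≤ 16 / 3 * (2 * (3 * √(3 : ℝ))⁻¹) by positivity)
  rw [hcoef] at this
  linarith

/-- Tuned learning rates for the data-rich and data-poor regimes.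
With `C_t = 5 + 2s·log(e·d·t/s)`:
(i) with `λ²_t = √(3 C_{t+1}/(128 d (t+1)))`, for any sequence `x_t ∈ [0, 2d]`,
`C_T/λ²_{T-1} + (32/3)∑_{t=1}^T λ²_{t-1} x_t ≤ 16 √((2/3) C_T d T)`;
(ii) with `λ³_t = (1/(4·6^{1/3}))(C_{t+1}√C_min/((t+1)√s))^{2/3}` and
`c₃* = 2·3^{-3/2}`, for any sequence `y_t ∈ [0, 54 s/C_min]`,
`C_T/λ³_{T-1} + (16/3) c₃* ∑_{t=1}^T √(3 λ³_{t-1} y_t) ≤ 12·6^{1/3} (s C_T/C_min)^{1/3} T^{2/3}`. -/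
theorem history_indep_learning_rates (d s T : ℕ) (hs : 1 ≤ s) (hsd : s ≤ d) (hT : 1 ≤ T)
    (C : ℕ → ℝ) (hC : ∀ t : ℕ, C t = 5 + 2 * s * Real.log (Real.exp 1 * d * t / s))
    (lam2 : ℕ → ℝ)
    (hlam2 : ∀ t : ℕ, lam2 t = Real.sqrt (3 * C (t + 1) / (128 * d * (t + 1))))
    (Cmin : ℝ) (hCmin : 0 < Cmin)
    (lam3 : ℕ → ℝ)
    (hlam3 : ∀ t : ℕ, lam3 t = (1 / (4 * (6 : ℝ) ^ ((1 : ℝ) / 3))) *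
      (C (t + 1) * Real.sqrt Cmin / ((t + 1) * Real.sqrt s)) ^ ((2 : ℝ) / 3))
    (x y : ℕ → ℝ)
    (hx : ∀ t, 1 ≤ t → t ≤ T → 0 ≤ x t ∧ x t ≤ 2 * d)
    (hy : ∀ t, 1 ≤ t → t ≤ T → 0 ≤ y t ∧ y t ≤ 54 * s / Cmin) :
    C T / lam2 (T - 1) + (32 / 3) * ∑ t ∈ Finset.Icc 1 T, lam2 (t - 1) * x t ≤
        16 * Real.sqrt ((2 / 3) * (C T * (d * T))) ∧
    C T / lam3 (T - 1) +
        (16 / 3) * (2 * (3 : ℝ) ^ (-(3 / 2) : ℝ)) *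
          ∑ t ∈ Finset.Icc 1 T, Real.sqrt (3 * lam3 (t - 1) * y t) ≤
      12 * (6 : ℝ) ^ ((1 : ℝ) / 3) * (s * C T / Cmin) ^ ((1 : ℝ) / 3) *
        (T : ℝ) ^ ((2 : ℝ) / 3) := by
  have hs0 : (0 : ℝ) < s := by exact_mod_cast hs
  have hsd' : (s : ℝ) ≤ d := by exact_mod_cast hsd
  have hd0 : (0 : ℝ) < d := hs0.trans_le hsd'
  have hpos : ∀ t, 1 ≤ t → 0 < C t := by
    intro t ht
    have ht1 : (1 : ℝ) ≤ t := by exact_mod_cast ht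
    have hlog : 0 ≤ Real.log (Real.exp 1 * d * t / s) := by
      refine Real.log_nonneg ((one_le_div hs0).2 ?_)
      have he := Real.one_le_exp zero_le_one
      calc (s : ℝ) ≤ 1 * d * 1 := by simpa using hsd'
        _ ≤ Real.exp 1 * d * t := by gcongr
    rw [hC]
    positivity
  have hmono : ∀ t, 1 ≤ t → t ≤ T → C t ≤ C T := by
    intro t ht htT
    have ht0 : (0 : ℝ) < t := by exact_mod_cast ht
    rw [hC, hC]
    gcongr
  exact ⟨sqrt_rate_bound hd0 hT hpos hmono hlam2 hx,
    cbrt_rate_bound hs0 hCmin hT hpos hmono hlam3 hy⟩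
end
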